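/- Let u ≥ 2 and v ≥ 2 be integers. For every integer n with |n| ≥ 2 and every x in the free group F(a,b), the element x*(a*b⁻¹)^n*x⁻¹ does not lie in the subgroup of F(a,b) generated by {b*a^u, b^v}. -/

import Mathlib

noncomputable def a : FreeGroup Bool := FreeGroup.of false
noncomputable def b : FreeGroup Bool := FreeGroup.of true

open Polynomial Matrix

/-- The trace of a power of a `2 × 2` matrix satisfies the Cayley–Hamilton recurrence. -/
lemma trace_pow_add_two {R : Type*} [CommRing R] (M : Matrix (Fin 2) (Fin 2) R) (n : ℕ) :
    (M ^ (n + 2)).trace = M.trace * (M ^ (n + 1)).trace - M.det * (M ^ n).trace := by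
  have h : M ^ 2 = M.trace • M - M.det • (1 : Matrix (Fin 2) (Fin 2) R) := by
    ext i j
    fin_cases i <;> fin_cases j <;>
      simp [pow_two, Matrix.mul_apply, Fin.sum_univ_two, trace_fin_two, det_fin_two] <;> ring
  rw [pow_add, h, mul_sub, trace_sub, mul_smul_comm, mul_smul_comm, ← pow_succ, mul_one,
    trace_smul, trace_smul, smul_eq_mul, smul_eq_mul]

/-- If the trace of `M` has degree one and its determinant is constant, then the trace of `M ^ n`
has degree `n`. -/
lemma degree_trace_pow {K : Type*} [Field K] [CharZero K] {M : Matrix (Fin 2) (Fin 2) K[X]}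
    (ht : M.trace.degree = 1) (hd : M.det.degree ≤ 0) (n : ℕ) :
    (M ^ n).trace.degree = n := by
  induction n using Nat.twoStepInduction with
  | zero =>
    have h : (2 : K[X]) = C 2 := rfl
    simp [h, degree_C]
  | one => simpa using ht
  | more n h₀ h₁ =>
    have hlead : (M.trace * (M ^ (n + 1)).trace).degree = ((n + 2 : ℕ) : WithBot ℕ) := by
      rw [degree_mul, ht, h₁]
      norm_cast
      ring_nf
    have hlt : (M.det * (M ^ n).trace).degree < ((n + 2 : ℕ) : WithBot ℕ) := by
      rw [degree_mul, h₀]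
      calc M.det.degree + (n : WithBot ℕ) ≤ 0 + (n : WithBot ℕ) := by gcongr
        _ < ((n + 2 : ℕ) : WithBot ℕ) := by rw [zero_add]; norm_cast; omega
    rw [trace_pow_add_two, degree_sub_eq_left_of_degree_lt (by rwa [hlead]), hlead]

/-- The unipotent matrix with upper right entry the indeterminate. -/
noncomputable def upperUnipotent (K : Type*) [Field K] : (Matrix (Fin 2) (Fin 2) K[X])ˣ where
  val := !![1, X; 0, 1]
  inv := !![1, -X; 0, 1]
  val_inv := by simp [one_fin_two]
  inv_val := by simp [one_fin_two]

/-- A lower triangular matrix with eigenvalues `ζ` and `1`. -/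
noncomputable def lowerTriangular {K : Type*} [Field K] (ζ : Kˣ) :
    (Matrix (Fin 2) (Fin 2) K[X])ˣ where
  val := !![C (ζ : K), 0; 1, 1]
  inv := !![C (↑ζ⁻¹ : K), 0; -C (↑ζ⁻¹ : K), 1]
  val_inv := by simp [one_fin_two, ← C_mul]
  inv_val := by simp [one_fin_two, ← C_mul]

lemma upperUnipotent_pow (K : Type*) [Field K] (n : ℕ) :
    (upperUnipotent K : Matrix (Fin 2) (Fin 2) K[X]) ^ n = !![1, C (n : K) * X; 0, 1] := by
  induction n with
  | zero => simp [one_fin_two]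
  | succ n ih =>
    rw [pow_succ, ih]
    simp [upperUnipotent]
    ring

lemma lowerTriangular_pow {K : Type*} [Field K] (ζ : Kˣ) (n : ℕ) :
    (lowerTriangular ζ : Matrix (Fin 2) (Fin 2) K[X]) ^ n =
      !![C ((ζ : K) ^ n), 0; C (∑ i ∈ Finset.range n, (ζ : K) ^ i), 1] := by
  induction n with
  | zero => simp [one_fin_two]
  | succ n ih =>
    rw [pow_succ', ih, geom_sum_succ']
    simp [lowerTriangular, pow_succ']

lemma lowerTriangular_pow_eq_one {K : Type*} [Field K] {ζ : Kˣ} {v : ℕ} (hv : 1 < v)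
    (hζ : IsPrimitiveRoot (ζ : K) v) : lowerTriangular ζ ^ v = 1 := by
  ext1
  rw [Units.val_pow_eq_pow_val, lowerTriangular_pow, hζ.pow_eq_one, hζ.geom_sum_eq_zero hv]
  simp [one_fin_two]

lemma degree_trace_upper_mul_lower_inv_pow {K : Type*} [Field K] [CharZero K] (ζ : Kˣ) (n : ℕ) :
    (((upperUnipotent K * (lowerTriangular ζ)⁻¹) ^ n : (Matrix (Fin 2) (Fin 2) K[X])ˣ) :
      Matrix (Fin 2) (Fin 2) K[X]).trace.degree = n := by
  have hM : ((upperUnipotent K * (lowerTriangular ζ)⁻¹ : (Matrix (Fin 2) (Fin 2) K[X])ˣ) :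
      Matrix (Fin 2) (Fin 2) K[X]) =
      !![C (↑ζ⁻¹ : K) - X * C (↑ζ⁻¹ : K), X; -C (↑ζ⁻¹ : K), 1] := by
    change !![1, X; 0, 1] * !![C (↑ζ⁻¹ : K), 0; -C (↑ζ⁻¹ : K), 1] = _
    simp [sub_eq_add_neg]
  rw [Units.val_pow_eq_pow_val, hM]
  apply degree_trace_pow
  · rw [show (!![C (↑ζ⁻¹ : K) - X * C (↑ζ⁻¹ : K), X; -C (↑ζ⁻¹ : K), 1]).trace =
        C (-(↑ζ⁻¹ : K)) * X + C ((↑ζ⁻¹ : K) + 1) by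
      rw [trace_fin_two_of, C_neg, C_add, C_1]; ring]
    exact degree_linear (neg_ne_zero.mpr ζ⁻¹.ne_zero)
  · rw [show (!![C (↑ζ⁻¹ : K) - X * C (↑ζ⁻¹ : K), X; -C (↑ζ⁻¹ : K), 1]).det = C (↑ζ⁻¹ : K) by
      rw [det_fin_two_of]; ring]
    exact degree_C_le

lemma degree_trace_lower_mul_upper_pow_pow {K : Type*} [Field K] [CharZero K] (ζ : Kˣ) {u : ℕ}
    (hu : u ≠ 0) (n : ℕ) :
    (((lowerTriangular ζ * upperUnipotent K ^ u) ^ n : (Matrix (Fin 2) (Fin 2) K[X])ˣ) :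
      Matrix (Fin 2) (Fin 2) K[X]).trace.degree = n := by
  have hM : ((lowerTriangular ζ * upperUnipotent K ^ u : (Matrix (Fin 2) (Fin 2) K[X])ˣ) :
      Matrix (Fin 2) (Fin 2) K[X]) =
      !![C (ζ : K), C (ζ : K) * (C (u : K) * X); 1, C (u : K) * X + 1] := by
    rw [Units.val_mul, Units.val_pow_eq_pow_val, upperUnipotent_pow]
    simp [lowerTriangular]
  rw [Units.val_pow_eq_pow_val, hM]
  apply degree_trace_pow
  · rw [show (!![C (ζ : K), C (ζ : K) * (C (u : K) * X); 1, C (u : K) * X + 1]).trace =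
        C (u : K) * X + C ((ζ : K) + 1) by
      rw [trace_fin_two_of, C_add, C_1]; ring]
    exact degree_linear (Nat.cast_ne_zero.mpr hu)
  · rw [show (!![C (ζ : K), C (ζ : K) * (C (u : K) * X); 1, C (u : K) * X + 1]).det = C (ζ : K) by
      rw [det_fin_two_of]; ring]
    exact degree_C_le

/-- The case of positive exponents, which holds already for `n = 1`. -/
lemma conj_pow_notMem_closure {u v n : ℕ} (hu : 2 ≤ u) (hv : 2 ≤ v) (hn : 0 < n)
    (x : FreeGroup Bool) :
    x * (a * b⁻¹) ^ n * x⁻¹ ∉ Subgroup.closure {b * a ^ u, b ^ v} := by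
  intro hmem
  have hζ := Complex.isPrimitiveRoot_exp v (by omega)
  obtain ⟨ζ, hζu⟩ := hζ.isUnit (by omega)
  rw [← hζu] at hζ
  let φ : FreeGroup Bool →* (Matrix (Fin 2) (Fin 2) ℂ[X])ˣ :=
    FreeGroup.lift fun i => if i then lowerTriangular ζ else upperUnipotent ℂ
  let α : FreeGroup Bool →* Multiplicative ℤ :=
    FreeGroup.lift fun i => if i then 1 else Multiplicative.ofAdd 1
  have hφa : φ a = upperUnipotent ℂ := by simp [φ, a]
  have hφb : φ b = lowerTriangular ζ := by simp [φ, b]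
  have hαa : α a = Multiplicative.ofAdd 1 := by simp [α, a]
  have hαb : α b = 1 := by simp [α, b]
  have hle : Subgroup.closure {b * a ^ u, b ^ v} ≤
      (Subgroup.zpowers ((φ.prod α) (b * a ^ u))).comap (φ.prod α) := by
    rw [Subgroup.closure_le]
    rintro y (rfl | rfl)
    · exact Subgroup.mem_zpowers _
    · have h : (φ.prod α) (b ^ v) = 1 := by
        simp [hφb, hαb, lowerTriangular_pow_eq_one hv hζ]
      simp only [SetLike.mem_coe, Subgroup.mem_comap, h, one_mem]
  obtain ⟨k, hk⟩ := Subgroup.mem_zpowers_iff.mp (hle hmem)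
  have hkα := congrArg (fun p => p.2.toAdd) hk
  have hkφ := congrArg Prod.fst hk
  simp [hαa, hαb] at hkα
  have hk0 : 0 < k := by
    by_contra! h
    nlinarith
  lift k to ℕ using hk0.le
  norm_cast at hkα hk0
  have hconj : (lowerTriangular ζ * upperUnipotent ℂ ^ u) ^ k =
      φ x * (upperUnipotent ℂ * (lowerTriangular ζ)⁻¹) ^ n * (φ x)⁻¹ := by
    simpa [hφa, hφb] using hkφ
  have hdeg := degree_trace_lower_mul_upper_pow_pow ζ (show u ≠ 0 by omega) k
  rw [hconj, Units.val_mul, Units.val_mul, trace_units_conj,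
    degree_trace_upper_mul_lower_inv_pow] at hdeg
  norm_cast at hdeg
  nlinarith

/-- For `u, v ≥ 2` and `|n| ≥ 2`, no conjugate `x * (a*b⁻¹)^n * x⁻¹` lies in the
subgroup of F(a,b) generated by `{b*a^u, b^v}`. -/
theorem conj_pow_not_mem' (u v : ℤ) (hu : 2 ≤ u) (hv : 2 ≤ v)
    (n : ℤ) (hn : 2 ≤ |n|) (x : FreeGroup Bool) :
    x * (a * b⁻¹) ^ n * x⁻¹ ∉ Subgroup.closure {b * a ^ u, b ^ v} := by
  lift u to ℕ using by omega
  lift v to ℕ using by omega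
  norm_cast at hu hv
  simp only [zpow_natCast]
  obtain ⟨m, rfl | rfl⟩ := n.eq_nat_or_neg
  · rw [zpow_natCast]
    exact conj_pow_notMem_closure hu hv (by simp at hn; omega) x
  · intro h
    refine conj_pow_notMem_closure hu hv (n := m) (by simp at hn; omega) x ?_
    convert inv_mem h using 1
    simp [mul_assoc]
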